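/- The linear map 𝒟(X) → 𝒫(X)^* sending f to the functional p ↦ ⟨p,f⟩ is an isomorphism of vector spaces; in particular 𝒫(X) and 𝒟(X) are dual under the pairing ⟨·,·⟩. -/

import Mathlib

noncomputable section

variable {r N : ℕ}

/-- `p_u`, the degree-one polynomial associated with the vector `u ∈ ℝ^r`. -/
def linPoly {r : ℕ} (u : Fin r → ℝ) : MvPolynomial (Fin r) ℝ :=
  ∑ i, MvPolynomial.C (u i) * MvPolynomial.X i

/-- `p_Y = ∏_{i ∈ Y} p_{X i}` for a sublist `Y` of the list `X`. -/
def prodPoly {r N : ℕ} (X : Fin N → Fin r → ℝ) (Y : Finset (Fin N)) : MvPolynomial (Fin r) ℝ :=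
  ∏ i ∈ Y, linPoly (X i)

/-- The pairing `⟨p, f⟩ = (p(∂/∂t₁,…,∂/∂t_r) f)(0)`, written via coefficients:
`⟨p,f⟩ = ∑_α α! · p_α · f_α`. -/
def pairing {r : ℕ} (p f : MvPolynomial (Fin r) ℝ) : ℝ :=
  ∑ α ∈ p.support, (∏ i, ((α i).factorial : ℝ)) * p.coeff α * f.coeff α

lemma pairing_zero {r : ℕ} (q : MvPolynomial (Fin r) ℝ) : pairing q 0 = 0 := by
  simp [pairing]

lemma pairing_add {r : ℕ} (q f g : MvPolynomial (Fin r) ℝ) :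
    pairing q (f + g) = pairing q f + pairing q g := by
  unfold pairing
  rw [← Finset.sum_add_distrib]
  exact Finset.sum_congr rfl fun α _ => by rw [MvPolynomial.coeff_add]; ring

lemma pairing_smul {r : ℕ} (q : MvPolynomial (Fin r) ℝ) (c : ℝ) (f : MvPolynomial (Fin r) ℝ) :
    pairing q (c • f) = c * pairing q f := by
  unfold pairing
  rw [Finset.mul_sum]
  exact Finset.sum_congr rfl fun α _ => by rw [MvPolynomial.coeff_smul, smul_eq_mul]; ring

/-- The kernel (Macaulay inverse system) of an ideal `I`:
all polynomials annihilated (in the sense of the pairing) by every element of `I`. -/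
def kerIdeal {r : ℕ} (I : Ideal (MvPolynomial (Fin r) ℝ)) :
    Submodule ℝ (MvPolynomial (Fin r) ℝ) where
  carrier := {f | ∀ q ∈ I, pairing q f = 0}
  add_mem' := fun hf hg q hq => by
    rw [pairing_add, hf q hq, hg q hq, add_zero]
  zero_mem' := fun q _ => pairing_zero q
  smul_mem' := fun c f hf q hq => by
    rw [pairing_smul, hf q hq, mul_zero]

section Lists

variable {M : Type*} [AddCommGroup M] [Module ℝ M]

/-- `B ⊆ G` is (the index set of) a sublist of the list `v` restricted to the ground set `G`
that is a basis of the ambient space. -/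
def basesOn (v : Fin N → M) (G : Finset (Fin N)) : Set (Finset (Fin N)) :=
  {B | B ⊆ G ∧ LinearIndependent ℝ ((B : Set (Fin N)).restrict v) ∧
    Submodule.span ℝ (v '' (B : Set (Fin N))) = ⊤}

/-- `j` is externally active with respect to the basis `B`:
`v j ∈ span {v e : e ∈ B, e ≤ j}` and `j ∉ B`. -/
def isExtActive (v : Fin N → M) (B : Finset (Fin N)) (j : Fin N) : Prop :=
  j ∉ B ∧ v j ∈ Submodule.span ℝ (v '' {e : Fin N | e ∈ B ∧ e ≤ j})

open Classical in
/-- The set `E(B)` of externally active elements (within the ground set `G`). -/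
def extSetOn (v : Fin N → M) (G B : Finset (Fin N)) : Finset (Fin N) :=
  G.filter (fun j => isExtActive v B j)

/-- `C` is a cocircuit w.r.t. the collection of bases `𝔅`: an inclusion-minimal
sublist of the ground set `G` intersecting every basis in `𝔅`. -/
def isCocircuitOn (G : Finset (Fin N)) (𝔅 : Set (Finset (Fin N))) (C : Finset (Fin N)) : Prop :=
  C ⊆ G ∧ (∀ B ∈ 𝔅, (C ∩ B).Nonempty) ∧
    ∀ C' ⊆ C, (∀ B ∈ 𝔅, (C' ∩ B).Nonempty) → C' = C

/-- A set of bases `𝔅` of the list `v` has the forward exchange property. -/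
def forwardExchange (v : Fin N → M) (𝔅 : Set (Finset (Fin N))) : Prop :=
  ∀ B ∈ 𝔅, ∀ b ∈ B, ∀ j : Fin N,
    v j ∈ Submodule.span ℝ (v '' {e : Fin N | e ∈ B ∧ e ≤ b}) →
    v j ∉ Submodule.span ℝ (v '' {e : Fin N | e ∈ B ∧ e < b}) →
    ¬ isExtActive v B j →
    insert j (B.erase b) ∈ 𝔅

end Lists

/-- The ideal `𝒥` generated by the cocircuit polynomials `p_C`. -/
def Jideal (X : Fin N → Fin r → ℝ) (G : Finset (Fin N)) (𝔅 : Set (Finset (Fin N))) :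
    Ideal (MvPolynomial (Fin r) ℝ) :=
  Ideal.span {p | ∃ C : Finset (Fin N), isCocircuitOn G 𝔅 C ∧ p = prodPoly X C}

/-- The generalised `𝒟`-space: the kernel of the cocircuit ideal. -/
def Dspace (X : Fin N → Fin r → ℝ) (G : Finset (Fin N)) (𝔅 : Set (Finset (Fin N))) :
    Submodule ℝ (MvPolynomial (Fin r) ℝ) :=
  kerIdeal (Jideal X G 𝔅)

/-- `Q_B := p_{X∖(B ∪ E(B))}` (within the ground set `G`). -/
def QB (X : Fin N → Fin r → ℝ) (G B : Finset (Fin N)) : MvPolynomial (Fin r) ℝ :=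
  prodPoly X (G \ (B ∪ extSetOn X G B))

/-- The central `𝒫`-space: the span of `p_Y` over sublists `Y` of `G` whose complement spans. -/
def PspaceOn (X : Fin N → Fin r → ℝ) (G : Finset (Fin N)) :
    Submodule ℝ (MvPolynomial (Fin r) ℝ) :=
  Submodule.span ℝ {p | ∃ Y : Finset (Fin N), Y ⊆ G ∧
    Submodule.span ℝ (X '' ((G \ Y : Finset (Fin N)) : Set (Fin N))) = ⊤ ∧ p = prodPoly X Y}

/-- The generalised `𝒫`-space `𝒫(X,𝔅') = span {Q_B : B ∈ 𝔅'}`. -/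
def PspaceB (X : Fin N → Fin r → ℝ) (G : Finset (Fin N)) (𝔅 : Set (Finset (Fin N))) :
    Submodule ℝ (MvPolynomial (Fin r) ℝ) :=
  Submodule.span ℝ {p | ∃ B ∈ 𝔅, p = QB X G B}

/-- The directional derivative `D_u = ∑ i, uᵢ ∂/∂tᵢ` as a linear map. -/
def dirDeriv {r : ℕ} (u : Fin r → ℝ) :
    MvPolynomial (Fin r) ℝ →ₗ[ℝ] MvPolynomial (Fin r) ℝ :=
  ∑ i, u i • (MvPolynomial.pderiv i).toLinearMap

end

open MeasureTheory Filter Topology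

section PairingLeft

variable {r : ℕ}

lemma pairing_eq_sum_of_support_subset {p : MvPolynomial (Fin r) ℝ} {s : Finset (Fin r →₀ ℕ)}
    (hs : p.support ⊆ s) (f : MvPolynomial (Fin r) ℝ) :
    pairing p f = ∑ α ∈ s, (∏ i, ((α i).factorial : ℝ)) * p.coeff α * f.coeff α := by
  refine Finset.sum_subset hs fun α _ hα => ?_
  rw [MvPolynomial.notMem_support_iff.mp hα]
  ring

lemma pairing_add_left (p q f : MvPolynomial (Fin r) ℝ) :
    pairing (p + q) f = pairing p f + pairing q f := by
  classical
  rw [pairing_eq_sum_of_support_subset MvPolynomial.support_add,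
    pairing_eq_sum_of_support_subset (p := p) Finset.subset_union_left,
    pairing_eq_sum_of_support_subset (p := q) Finset.subset_union_right,
    ← Finset.sum_add_distrib]
  exact Finset.sum_congr rfl fun α _ => by rw [MvPolynomial.coeff_add]; ring

lemma pairing_smul_left (c : ℝ) (p f : MvPolynomial (Fin r) ℝ) :
    pairing (c • p) f = c * pairing p f := by
  rw [pairing_eq_sum_of_support_subset MvPolynomial.support_smul, pairing, Finset.mul_sum]
  exact Finset.sum_congr rfl fun α _ => by rw [MvPolynomial.coeff_smul, smul_eq_mul]; ring

/-- The pairing as a bilinear map, with the differentiated polynomial as first argument. -/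
noncomputable def pairingBilin (r : ℕ) :
    MvPolynomial (Fin r) ℝ →ₗ[ℝ] MvPolynomial (Fin r) ℝ →ₗ[ℝ] ℝ :=
  LinearMap.mk₂ ℝ (fun f p => pairing p f) (fun f g p => pairing_add p f g)
    (fun c f p => pairing_smul p c f) (fun f p q => pairing_add_left p q f)
    (fun c f p => pairing_smul_left c p f)

lemma pairingBilin_apply (f p : MvPolynomial (Fin r) ℝ) : pairingBilin r f p = pairing p f := rfl

lemma pairing_monomial_one (α : Fin r →₀ ℕ) (f : MvPolynomial (Fin r) ℝ) :
    pairing (MvPolynomial.monomial α 1) f = (∏ i, ((α i).factorial : ℝ)) * f.coeff α := by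
  classical
  rw [pairing_eq_sum_of_support_subset MvPolynomial.support_monomial_subset,
    Finset.sum_singleton, MvPolynomial.coeff_monomial, if_pos rfl, mul_one]

lemma prod_factorial_ne_zero (α : Fin r →₀ ℕ) : (∏ i, ((α i).factorial : ℝ)) ≠ 0 :=
  Finset.prod_ne_zero_iff.mpr fun _ _ => Nat.cast_ne_zero.mpr (Nat.factorial_ne_zero _)

lemma eq_zero_of_forall_pairing_eq_zero {f : MvPolynomial (Fin r) ℝ}
    (h : ∀ p, pairing p f = 0) : f = 0 := by
  ext α
  have := h (MvPolynomial.monomial α 1)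
  rw [pairing_monomial_one] at this
  simpa [prod_factorial_ne_zero α] using this

/-- A functional vanishing on monomials of large degree is represented by a polynomial. -/
lemma exists_pairing_eq (ψ : MvPolynomial (Fin r) ℝ →ₗ[ℝ] ℝ) (n : ℕ)
    (h : ∀ α : Fin r →₀ ℕ, n < α.degree → ψ (MvPolynomial.monomial α 1) = 0) :
    ∃ f, ∀ p, pairing p f = ψ p := by
  classical
  have hfin : {α : Fin r →₀ ℕ | α.degree ≤ n}.Finite := Finsupp.finite_of_degree_le n
  let f : MvPolynomial (Fin r) ℝ := ∑ α ∈ hfin.toFinset,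
    MvPolynomial.monomial α ((∏ i, ((α i).factorial : ℝ))⁻¹ * ψ (MvPolynomial.monomial α 1))
  refine ⟨f, fun p => ?_⟩
  suffices pairingBilin r f = ψ from LinearMap.congr_fun this p
  refine (MvPolynomial.basisMonomials (Fin r) ℝ).ext fun α => ?_
  rw [MvPolynomial.coe_basisMonomials, pairingBilin_apply, pairing_monomial_one]
  simp only [f, MvPolynomial.coeff_sum, MvPolynomial.coeff_monomial, Finset.sum_ite_eq',
    Set.Finite.mem_toFinset, Set.mem_ofPred_eq]
  split_ifs with hα
  · rw [mul_inv_cancel_left₀ (prod_factorial_ne_zero α)]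
  · rw [mul_zero, h α (not_le.mp hα)]

end PairingLeft

section Evaluation

variable {r N : ℕ}

lemma eval_linPoly (u v : Fin r → ℝ) : MvPolynomial.eval v (linPoly u) = u ⬝ᵥ v := by
  simp [linPoly, dotProduct]

/-- `p_u` depends linearly on `u`. -/
noncomputable def linPolyₗ (r : ℕ) : (Fin r → ℝ) →ₗ[ℝ] MvPolynomial (Fin r) ℝ where
  toFun := linPoly
  map_add' u v := by simp [linPoly, add_mul, Finset.sum_add_distrib]
  map_smul' c u := by
    simp [linPoly, MvPolynomial.smul_eq_C_mul, Finset.mul_sum, mul_assoc]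

lemma linPoly_single (i : Fin r) : linPoly (Pi.single i 1) = MvPolynomial.X i := by
  rw [linPoly, Finset.sum_eq_single i]
  · simp
  · intro j _ hj
    simp [hj]
  · simp

lemma linPoly_zero : linPoly (0 : Fin r → ℝ) = 0 := (linPolyₗ r).map_zero

lemma exists_dotProduct_ne_zero {S : Set (Fin r → ℝ)} (hS : Submodule.span ℝ S = ⊤)
    {η : Fin r → ℝ} (hη : η ≠ 0) : ∃ u ∈ S, u ⬝ᵥ η ≠ 0 := by
  by_contra! h
  have hle : ∀ u ∈ Submodule.span ℝ S, u ⬝ᵥ η = 0 := fun u hu => by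
    induction hu using Submodule.span_induction with
    | mem x hx => exact h x hx
    | zero => exact zero_dotProduct _
    | add x y _ _ hx hy => rw [add_dotProduct, hx, hy, add_zero]
    | smul c x _ hx => rw [smul_dotProduct, hx, smul_zero]
  exact hη (dotProduct_self_eq_zero.mp (hle η (hS ▸ Submodule.mem_top)))

lemma exists_orthogonal_of_span_ne_top {S : Set (Fin r → ℝ)} (hS : Submodule.span ℝ S ≠ ⊤) :
    ∃ η : Fin r → ℝ, η ≠ 0 ∧ ∀ u ∈ S, u ⬝ᵥ η = 0 := by
  obtain ⟨f, hf, hle⟩ := Submodule.exists_le_ker_of_lt_top _ (lt_top_iff_ne_top.mpr hS)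
  have key : ∀ u, u ⬝ᵥ (fun i => f (Pi.single i 1)) = f u := fun u => by
    rw [LinearMap.pi_apply_eq_sum_univ f u]
    refine Finset.sum_congr rfl fun i _ =>
      congrArg (fun w => u i * f w) (funext fun j => ?_)
    simp [Pi.single_apply, eq_comm]
  refine ⟨fun i => f (Pi.single i 1), fun h0 => hf ?_, fun u hu => ?_⟩
  · refine LinearMap.ext fun u => ?_
    rw [← key, h0, dotProduct_zero, LinearMap.zero_apply]
  · rw [key]
    exact hle (Submodule.subset_span hu)

lemma ae_dotProduct_ne_zero {u : Fin r → ℝ} (hu : u ≠ 0) :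
    ∀ᵐ v : Fin r → ℝ, u ⬝ᵥ v ≠ 0 := by
  have := Measure.addHaar_submodule (volume : Measure (Fin r → ℝ))
    (LinearMap.ker (dotProductBilin ℝ ℝ u)) (fun h => hu ?_)
  · rw [ae_iff]
    convert this using 2
    ext v
    simp
  · have : u ∈ LinearMap.ker (dotProductBilin ℝ ℝ u) := h ▸ Submodule.mem_top
    exact dotProduct_self_eq_zero.mp (by simpa using this)

lemma eq_zero_of_eval_ae_eq_zero {p : MvPolynomial (Fin r) ℝ}
    (h : (fun v => MvPolynomial.eval v p) =ᵐ[volume] 0) : p = 0 := by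
  have := (Continuous.ae_eq_iff_eq volume (MvPolynomial.continuous_eval p)
    continuous_zero).mp h
  exact MvPolynomial.funext fun v => by simpa using congr_fun this v

end Evaluation

section Differences

variable {r : ℕ}

/-- The iterated forward difference with steps taken from a list. -/
def multiDiff (L : List (Fin r → ℝ)) (f : (Fin r → ℝ) → ℝ) : (Fin r → ℝ) → ℝ :=
  L.foldr (fun η g => fwdDiff η g) f

lemma multiDiff_cons (η : Fin r → ℝ) (L : List (Fin r → ℝ)) (f : (Fin r → ℝ) → ℝ) :
    multiDiff (η :: L) f = fwdDiff η (multiDiff L f) := rfl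

lemma multiDiff_append (L L' : List (Fin r → ℝ)) (f : (Fin r → ℝ) → ℝ) :
    multiDiff (L ++ L') f = multiDiff L (multiDiff L' f) := by
  simp [multiDiff]

lemma multiDiff_replicate (n : ℕ) (η : Fin r → ℝ) (f : (Fin r → ℝ) → ℝ) :
    multiDiff (List.replicate n η) f = (fwdDiff η)^[n] f := by
  induction n with
  | zero => rfl
  | succ n ih => rw [List.replicate_succ, multiDiff_cons, ih, Function.iterate_succ_apply']

lemma multiDiff_add (L : List (Fin r → ℝ)) (f g : (Fin r → ℝ) → ℝ) :
    multiDiff L (f + g) = multiDiff L f + multiDiff L g := by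
  induction L with
  | nil => rfl
  | cons η L ih => simp only [multiDiff_cons, ih, fwdDiff_add]

lemma multiDiff_zero (L : List (Fin r → ℝ)) : multiDiff L 0 = 0 := by
  simpa using multiDiff_add L 0 0

lemma fwdDiff_fwdDiff_comm (η ξ : Fin r → ℝ) (f : (Fin r → ℝ) → ℝ) :
    fwdDiff η (fwdDiff ξ f) = fwdDiff ξ (fwdDiff η f) := by
  ext v
  simp only [fwdDiff, add_right_comm v η ξ]
  ring

lemma multiDiff_fwdDiff (L : List (Fin r → ℝ)) (η : Fin r → ℝ) (f : (Fin r → ℝ) → ℝ) :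
    multiDiff L (fwdDiff η f) = fwdDiff η (multiDiff L f) := by
  induction L with
  | nil => rfl
  | cons ξ L ih => rw [multiDiff_cons, multiDiff_cons, ih, fwdDiff_fwdDiff_comm]

lemma multiDiff_comm (L L' : List (Fin r → ℝ)) (f : (Fin r → ℝ) → ℝ) :
    multiDiff L (multiDiff L' f) = multiDiff L' (multiDiff L f) := by
  induction L with
  | nil => rfl
  | cons η L ih => rw [multiDiff_cons, multiDiff_cons, ih, multiDiff_fwdDiff]

lemma fwdDiff_congr_ae {f g : (Fin r → ℝ) → ℝ} (h : f =ᵐ[volume] g) (η : Fin r → ℝ) :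
    fwdDiff η f =ᵐ[volume] fwdDiff η g := by
  have h' := (measurePreserving_add_right volume η).quasiMeasurePreserving.ae_eq_comp h
  filter_upwards [h, h'] with v hv hv'
  simp only [Function.comp_apply] at hv'
  simp only [fwdDiff, hv, hv']

lemma multiDiff_congr_ae {f g : (Fin r → ℝ) → ℝ} (h : f =ᵐ[volume] g)
    (L : List (Fin r → ℝ)) : multiDiff L f =ᵐ[volume] multiDiff L g := by
  induction L with
  | nil => exact h
  | cons η L ih => exact fwdDiff_congr_ae ih η

/-- Functions killed by some iterated forward difference with nonzero steps. -/
def diffTorsion (r : ℕ) : AddSubmonoid ((Fin r → ℝ) → ℝ) where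
  carrier := {f | ∃ L : List (Fin r → ℝ), (∀ η ∈ L, η ≠ 0) ∧ multiDiff L f = 0}
  zero_mem' := ⟨[], by simp, rfl⟩
  add_mem' := by
    rintro f g ⟨L, hL, hf⟩ ⟨L', hL', hg⟩
    refine ⟨L ++ L', fun η hη => (List.mem_append.mp hη).elim (hL η) (hL' η), ?_⟩
    rw [multiDiff_append, multiDiff_add, hg, add_zero, multiDiff_comm, hf, multiDiff_zero]

/-- Functions tending to zero along every discrete ray. -/
def rayVanishing (r : ℕ) : Submodule ℝ ((Fin r → ℝ) → ℝ) where
  carrier := {f | ∀ η : Fin r → ℝ, η ≠ 0 → ∀ v,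
    Tendsto (fun n : ℕ => f (v + n • η)) atTop (𝓝 0)}
  zero_mem' _ _ _ := tendsto_const_nhds
  add_mem' hf hg η hη v := by simpa using (hf η hη v).add (hg η hη v)
  smul_mem' c f hf η hη v := by simpa using (hf η hη v).const_mul c

lemma fwdDiff_mem_rayVanishing {f : (Fin r → ℝ) → ℝ} (hf : f ∈ rayVanishing r)
    (ξ : Fin r → ℝ) : fwdDiff ξ f ∈ rayVanishing r := by
  intro η hη v
  have := (hf η hη (v + ξ)).sub (hf η hη v)
  simpa [fwdDiff, add_right_comm] using this

lemma multiDiff_mem_rayVanishing {f : (Fin r → ℝ) → ℝ} (hf : f ∈ rayVanishing r)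
    (L : List (Fin r → ℝ)) : multiDiff L f ∈ rayVanishing r := by
  induction L with
  | nil => exact hf
  | cons η L ih => exact fwdDiff_mem_rayVanishing ih η

lemma ae_eq_zero_of_fwdDiff_ae_eq_zero {f : (Fin r → ℝ) → ℝ} (hf : f ∈ rayVanishing r)
    {η : Fin r → ℝ} (hη : η ≠ 0) (h : fwdDiff η f =ᵐ[volume] 0) : f =ᵐ[volume] 0 := by
  have h' : ∀ᵐ v : Fin r → ℝ, ∀ n : ℕ, fwdDiff η f (v + n • η) = 0 :=
    ae_all_iff.mpr fun n =>
      (measurePreserving_add_right volume (n • η)).quasiMeasurePreserving.ae h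
  filter_upwards [h'] with v hv
  have hconst : ∀ n : ℕ, f (v + n • η) = f v := fun n => by
    induction n with
    | zero => simp
    | succ n ih =>
      rw [← ih, succ_nsmul, ← add_assoc]
      exact sub_eq_zero.mp (hv n)
  have hlim := hf η hη v
  simp only [hconst] at hlim
  exact tendsto_nhds_unique tendsto_const_nhds hlim

lemma ae_eq_zero_of_multiDiff_ae_eq_zero {f : (Fin r → ℝ) → ℝ} (hf : f ∈ rayVanishing r)
    (L : List (Fin r → ℝ)) (hL : ∀ η ∈ L, η ≠ 0) (h : multiDiff L f =ᵐ[volume] 0) :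
    f =ᵐ[volume] 0 := by
  induction L with
  | nil => exact h
  | cons η L ih =>
    exact ih (fun ξ hξ => hL ξ (List.mem_cons_of_mem _ hξ))
      (ae_eq_zero_of_fwdDiff_ae_eq_zero (multiDiff_mem_rayVanishing hf L)
        (hL η List.mem_cons_self) h)

lemma ae_eq_zero_of_rayVanishing_of_diffTorsion {f g : (Fin r → ℝ) → ℝ}
    (hf : f ∈ rayVanishing r) (hg : g ∈ diffTorsion r) (h : f =ᵐ[volume] g) :
    f =ᵐ[volume] 0 := by
  obtain ⟨L, hL, hLg⟩ := hg
  exact ae_eq_zero_of_multiDiff_ae_eq_zero hf L hL (hLg ▸ multiDiff_congr_ae h L)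

lemma fwdDiff_iter_eval_eq_zero (a : MvPolynomial (Fin r) ℝ) (η : Fin r → ℝ) :
    (fwdDiff η)^[a.totalDegree + 1] (fun v => MvPolynomial.eval v a) = 0 := by
  ext v
  let ℓ : Fin r → Polynomial ℝ := fun i => Polynomial.C (η i) * Polynomial.X + Polynomial.C (v i)
  let q : Polynomial ℝ := MvPolynomial.aeval ℓ a
  have hdeg : q.natDegree < a.totalDegree + 1 := by
    have := MvPolynomial.aeval_natDegree_le a (le_refl a.totalDegree) ℓ (n := 1)
      fun i => Polynomial.natDegree_linear_le
    rw [mul_one] at this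
    exact Nat.lt_succ_of_le this
  have hq : ∀ k : ℕ, MvPolynomial.eval (v + k • η) a = q.eval (0 + k • (1 : ℝ)) := fun k => by
    have : q.eval (0 + k • (1 : ℝ)) =
        MvPolynomial.eval (fun i => (ℓ i).eval (0 + k • (1 : ℝ))) a := by
      simp only [q, ← Polynomial.coe_aeval_eq_eval]
      rw [MvPolynomial.comp_aeval_apply, MvPolynomial.aeval_eq_eval]
    rw [this]
    congr 2
    ext i
    simp [ℓ]
    ring
  have h0 := congr_fun (Polynomial.fwdDiff_iter_eq_zero_of_degree_lt hdeg) 0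
  rw [fwdDiff_iter_eq_sum_shift] at h0 ⊢
  simpa only [hq, Pi.zero_apply] using h0

lemma fwdDiff_iter_mul_of_periodic {η : Fin r → ℝ} {g : (Fin r → ℝ) → ℝ}
    (hg : ∀ v, g (v + η) = g v) (f : (Fin r → ℝ) → ℝ) (n : ℕ) :
    (fwdDiff η)^[n] (f * g) = (fwdDiff η)^[n] f * g := by
  induction n generalizing f with
  | zero => rfl
  | succ n ih =>
    have : fwdDiff η (f * g) = fwdDiff η f * g := by
      ext v
      simp only [fwdDiff, Pi.mul_apply, hg]
      ring
    rw [Function.iterate_succ_apply, this, ih, Function.iterate_succ_apply]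

end Differences

section Complement

variable {r N : ℕ}

/-- The function `∏_{i ∈ Y} 1 / p_{X i}`. -/
noncomputable def invProd (X : Fin N → Fin r → ℝ) (Y : Finset (Fin N)) : (Fin r → ℝ) → ℝ :=
  fun v => ∏ i ∈ Y, (X i ⬝ᵥ v)⁻¹

open Classical in
/-- The indices of the nonzero vectors of the list. -/
noncomputable def nonzeroIdx (X : Fin N → Fin r → ℝ) : Finset (Fin N) :=
  Finset.univ.filter fun i => X i ≠ 0

lemma mem_nonzeroIdx {X : Fin N → Fin r → ℝ} {i : Fin N} : i ∈ nonzeroIdx X ↔ X i ≠ 0 := by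
  simp [nonzeroIdx]

lemma prodPoly_eq_zero {X : Fin N → Fin r → ℝ} {Y : Finset (Fin N)} (h : ¬ Y ⊆ nonzeroIdx X) :
    prodPoly X Y = 0 := by
  obtain ⟨i, hi, hi'⟩ := Finset.not_subset.mp h
  rw [mem_nonzeroIdx, not_not] at hi'
  exact Finset.prod_eq_zero hi (by rw [hi', linPoly_zero])

lemma ae_forall_dotProduct_ne_zero (X : Fin N → Fin r → ℝ) :
    ∀ᵐ v : Fin r → ℝ, ∀ i ∈ nonzeroIdx X, X i ⬝ᵥ v ≠ 0 :=
  ae_all_iff.mpr fun i => by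
    by_cases hi : X i = 0
    · exact Eventually.of_forall fun v h => absurd hi (mem_nonzeroIdx.mp h)
    · exact (ae_dotProduct_ne_zero hi).mono fun v hv _ => hv

lemma prodPoly_mul_invProd_ae {X : Fin N → Fin r → ℝ} {Y : Finset (Fin N)}
    (hY : Y ⊆ nonzeroIdx X) :
    (fun v => MvPolynomial.eval v (prodPoly X Y) * invProd X (nonzeroIdx X) v) =ᵐ[volume]
      invProd X (nonzeroIdx X \ Y) := by
  filter_upwards [ae_forall_dotProduct_ne_zero X] with v hv
  simp only [invProd, prodPoly, map_prod, eval_linPoly]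
  rw [← Finset.prod_sdiff hY, mul_left_comm, ← Finset.prod_mul_distrib,
    Finset.prod_eq_one fun i hi => mul_inv_cancel₀ (hv i (hY hi)), mul_one]

lemma invProd_mem_rayVanishing {X : Fin N → Fin r → ℝ} {Y : Finset (Fin N)}
    (hY : Submodule.span ℝ (X '' (Y : Set (Fin N))) = ⊤) : invProd X Y ∈ rayVanishing r := by
  intro η hη v
  obtain ⟨_, ⟨j, hj, rfl⟩, hjη⟩ := exists_dotProduct_ne_zero hY hη
  have hlim : ∀ i ∈ Y, Tendsto (fun n : ℕ => (X i ⬝ᵥ (v + n • η))⁻¹) atTop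
      (𝓝 (if X i ⬝ᵥ η = 0 then (X i ⬝ᵥ v)⁻¹ else 0)) := fun i _ => by
    simp only [dotProduct_add, dotProduct_smul]
    split_ifs with h
    · simp [h]
    · simp only [nsmul_eq_mul]
      rcases lt_or_gt_of_ne h with h | h
      · exact tendsto_inv_atBot_zero.comp (tendsto_atBot_add_const_left _ _
          (tendsto_natCast_atTop_atTop.atTop_mul_const_of_neg h))
      · exact tendsto_inv_atTop_zero.comp (tendsto_atTop_add_const_left _ _
          (tendsto_natCast_atTop_atTop.atTop_mul_const h))
  have := tendsto_finsetProd Y hlim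
  rwa [Finset.prod_eq_zero hj (if_neg hjη)] at this

lemma eval_mul_invProd_mem_diffTorsion {X : Fin N → Fin r → ℝ} {Y : Finset (Fin N)}
    (hY : Submodule.span ℝ (X '' (Y : Set (Fin N))) ≠ ⊤) (a : MvPolynomial (Fin r) ℝ) :
    (fun v => MvPolynomial.eval v a) * invProd X Y ∈ diffTorsion r := by
  obtain ⟨η, hη, horth⟩ := exists_orthogonal_of_span_ne_top hY
  have hper : ∀ v, invProd X Y (v + η) = invProd X Y v := fun v =>
    Finset.prod_congr rfl fun i hi => by
      rw [dotProduct_add, horth _ (Set.mem_image_of_mem X hi), add_zero]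
  refine ⟨List.replicate (a.totalDegree + 1) η, fun ξ hξ => ?_, ?_⟩
  · rwa [List.eq_of_mem_replicate hξ]
  · rw [multiDiff_replicate, fwdDiff_iter_mul_of_periodic hper, fwdDiff_iter_eval_eq_zero,
      zero_mul]

lemma span_nonzeroIdx_sdiff (X : Fin N → Fin r → ℝ) (Y : Finset (Fin N)) :
    Submodule.span ℝ (X '' ((nonzeroIdx X \ Y : Finset (Fin N)) : Set (Fin N))) =
      Submodule.span ℝ (X '' ((Finset.univ \ Y : Finset (Fin N)) : Set (Fin N))) := by
  refine le_antisymm (Submodule.span_mono (Set.image_mono fun i hi => ?_))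
    (Submodule.span_le.mpr ?_)
  · simp_all
  · rintro _ ⟨i, hi, rfl⟩
    by_cases h0 : X i = 0
    · rw [h0]
      exact zero_mem _
    · refine Submodule.subset_span ⟨i, ?_, rfl⟩
      simp_all [mem_nonzeroIdx]

/-- A basis can be extracted from every spanning sublist. -/
lemma exists_mem_basesOn_subset {X : Fin N → Fin r → ℝ} {G : Finset (Fin N)}
    (hG : Submodule.span ℝ (X '' (G : Set (Fin N))) = ⊤) :
    ∃ B ∈ basesOn X Finset.univ, B ⊆ G := by
  classical
  obtain ⟨b, hbG, -, hspan, hli⟩ := exists_linearIndepOn_extension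
    (linearIndepOn_empty ℝ X) (Set.empty_subset (G : Set (Fin N)))
  refine ⟨b.toFinset, ⟨Finset.subset_univ _, ?_, ?_⟩, fun i hi => hbG (by simpa using hi)⟩
  · rw [Set.coe_toFinset]
    exact hli
  · rw [Set.coe_toFinset, eq_top_iff, ← hG]
    exact Submodule.span_le.mpr hspan

lemma span_sdiff_ne_top_of_isCocircuitOn {X : Fin N → Fin r → ℝ} {C : Finset (Fin N)}
    (hC : isCocircuitOn Finset.univ (basesOn X Finset.univ) C) :
    Submodule.span ℝ (X '' ((Finset.univ \ C : Finset (Fin N)) : Set (Fin N))) ≠ ⊤ := by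
  intro h
  obtain ⟨B, hB, hBC⟩ := exists_mem_basesOn_subset h
  obtain ⟨i, hi⟩ := hC.2.1 B hB
  rw [Finset.mem_inter] at hi
  exact (Finset.mem_sdiff.mp (hBC hi.2)).2 hi.1

lemma prodPoly_mem_Jideal {X : Fin N → Fin r → ℝ} {Y : Finset (Fin N)}
    (hY : Submodule.span ℝ (X '' ((Finset.univ \ Y : Finset (Fin N)) : Set (Fin N))) ≠ ⊤) :
    prodPoly X Y ∈ Jideal X Finset.univ (basesOn X Finset.univ) := by
  have hmeet : ∀ B ∈ basesOn X Finset.univ, (Y ∩ B).Nonempty := fun B hB => by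
    by_contra hempty
    rw [Finset.not_nonempty_iff_eq_empty, ← Finset.disjoint_iff_inter_eq_empty] at hempty
    refine hY (eq_top_iff.mpr (hB.2.2 ▸ Submodule.span_mono (Set.image_mono fun i hi => ?_)))
    simpa using Finset.disjoint_right.mp hempty hi
  obtain ⟨C, hCY, hC⟩ := exists_minimal_le_of_wellFoundedLT
    (fun C : Finset (Fin N) => ∀ B ∈ basesOn X Finset.univ, (C ∩ B).Nonempty) Y hmeet
  have hCJ : prodPoly X C ∈ Jideal X Finset.univ (basesOn X Finset.univ) :=
    Ideal.subset_span ⟨C, ⟨Finset.subset_univ _, hC.prop, fun C' hC' h =>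
      le_antisymm hC' (hC.le_of_le h hC')⟩, rfl⟩
  exact Ideal.mem_of_dvd _ (Finset.prod_dvd_prod_of_subset _ _ _ hCY) hCJ

lemma exists_rayVanishing_of_mem_PspaceOn {X : Fin N → Fin r → ℝ} {p : MvPolynomial (Fin r) ℝ}
    (hp : p ∈ PspaceOn X Finset.univ) : ∃ g ∈ rayVanishing r,
      (fun v => MvPolynomial.eval v p * invProd X (nonzeroIdx X) v) =ᵐ[volume] g := by
  induction hp using Submodule.span_induction with
  | mem p hp =>
    obtain ⟨Y, -, hY, rfl⟩ := hp
    by_cases h : Y ⊆ nonzeroIdx X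
    · exact ⟨_, invProd_mem_rayVanishing (span_nonzeroIdx_sdiff X Y ▸ hY),
        prodPoly_mul_invProd_ae h⟩
    · exact ⟨0, zero_mem _, Eventually.of_forall fun v => by simp [prodPoly_eq_zero h]⟩
  | zero => exact ⟨0, zero_mem _, Eventually.of_forall fun v => by simp⟩
  | add p q _ _ hp hq =>
    obtain ⟨g, hg, hpg⟩ := hp
    obtain ⟨g', hg', hqg⟩ := hq
    refine ⟨g + g', add_mem hg hg', ?_⟩
    filter_upwards [hpg, hqg] with v hv hv'
    rw [map_add, add_mul, hv, hv', Pi.add_apply]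
  | smul c p _ hp =>
    obtain ⟨g, hg, hpg⟩ := hp
    refine ⟨c • g, Submodule.smul_mem _ c hg, ?_⟩
    filter_upwards [hpg] with v hv
    rw [MvPolynomial.smul_eval, mul_assoc, hv, Pi.smul_apply, smul_eq_mul]

lemma exists_diffTorsion_of_mem_Jideal {X : Fin N → Fin r → ℝ} {p : MvPolynomial (Fin r) ℝ}
    (hp : p ∈ Jideal X Finset.univ (basesOn X Finset.univ)) : ∃ g ∈ diffTorsion r,
      (fun v => MvPolynomial.eval v p * invProd X (nonzeroIdx X) v) =ᵐ[volume] g := by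
  induction hp using Submodule.closure_induction with
  | zero => exact ⟨0, zero_mem _, Eventually.of_forall fun v => by simp⟩
  | add p q _ _ hp hq =>
    obtain ⟨g, hg, hpg⟩ := hp
    obtain ⟨g', hg', hqg⟩ := hq
    refine ⟨g + g', add_mem hg hg', ?_⟩
    filter_upwards [hpg, hqg] with v hv hv'
    rw [map_add, add_mul, hv, hv', Pi.add_apply]
  | smul_mem a p hp =>
    obtain ⟨C, hC, rfl⟩ := hp
    by_cases h : C ⊆ nonzeroIdx X
    · refine ⟨_, eval_mul_invProd_mem_diffTorsion (Y := nonzeroIdx X \ C)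
        (span_nonzeroIdx_sdiff X C ▸ span_sdiff_ne_top_of_isCocircuitOn hC) a, ?_⟩
      filter_upwards [prodPoly_mul_invProd_ae h] with v hv
      rw [smul_eq_mul, map_mul, mul_assoc, hv, Pi.mul_apply]
    · exact ⟨0, zero_mem _, Eventually.of_forall fun v => by simp [prodPoly_eq_zero h]⟩

lemma eq_zero_of_mem_PspaceOn_of_mem_Jideal {X : Fin N → Fin r → ℝ}
    {p : MvPolynomial (Fin r) ℝ} (hp : p ∈ PspaceOn X Finset.univ)
    (hp' : p ∈ Jideal X Finset.univ (basesOn X Finset.univ)) : p = 0 := by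
  obtain ⟨g, hg, hpg⟩ := exists_rayVanishing_of_mem_PspaceOn hp
  obtain ⟨h, hh, hph⟩ := exists_diffTorsion_of_mem_Jideal hp'
  have h0 := ae_eq_zero_of_rayVanishing_of_diffTorsion hg hh (hpg.symm.trans hph)
  refine eq_zero_of_eval_ae_eq_zero ?_
  filter_upwards [hpg.trans h0, ae_forall_dotProduct_ne_zero X] with v hv hne
  exact (mul_eq_zero.mp hv).resolve_right
    (Finset.prod_ne_zero_iff.mpr fun i hi => inv_ne_zero (hne i hi))

/-- If `X ∖ Y` spans, a variable times `p_Y` is a combination of the `p_{Y ∪ x}`, `x ∉ Y`. -/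
lemma prodPoly_mul_mul_X_mem {X : Fin N → Fin r → ℝ} {Y : Finset (Fin N)}
    (hY : Submodule.span ℝ (X '' ((Finset.univ \ Y : Finset (Fin N)) : Set (Fin N))) = ⊤)
    (S : Submodule ℝ (MvPolynomial (Fin r) ℝ)) (q : MvPolynomial (Fin r) ℝ)
    (hS : ∀ j ∉ Y, prodPoly X (insert j Y) * q ∈ S) (i : Fin r) :
    prodPoly X Y * (q * MvPolynomial.X i) ∈ S := by
  have key : ∀ u ∈ Submodule.span ℝ
      (X '' ((Finset.univ \ Y : Finset (Fin N)) : Set (Fin N))),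
      prodPoly X Y * (q * linPolyₗ r u) ∈ S := fun u hu => by
    induction hu using Submodule.span_induction with
    | mem x hx =>
      obtain ⟨j, hj, rfl⟩ := hx
      have hj' : j ∉ Y := by simpa using hj
      have := hS j hj'
      rw [prodPoly, Finset.prod_insert hj'] at this
      convert this using 1
      rw [prodPoly, show linPolyₗ r (X j) = linPoly (X j) from rfl]
      ring
    | zero => simp
    | add u w _ _ hu hw =>
      rw [map_add, mul_add, mul_add]
      exact add_mem hu hw
    | smul c u _ hu =>
      rw [map_smul, mul_smul_comm, mul_smul_comm]
      exact S.smul_mem c hu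
  have := key (Pi.single i 1) (hY ▸ Submodule.mem_top)
  rwa [show linPolyₗ r (Pi.single i 1) = MvPolynomial.X i from linPoly_single i] at this

lemma prodPoly_mul_mem_sup (X : Fin N → Fin r → ℝ) (q : MvPolynomial (Fin r) ℝ)
    (Y : Finset (Fin N)) : prodPoly X Y * q ∈ PspaceOn X Finset.univ ⊔
      (Jideal X Finset.univ (basesOn X Finset.univ)).restrictScalars ℝ := by
  induction q using MvPolynomial.induction_on generalizing Y with
  | C a =>
    rw [mul_comm, ← MvPolynomial.smul_eq_C_mul]
    refine Submodule.smul_mem _ a ?_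
    by_cases hY : Submodule.span ℝ
        (X '' ((Finset.univ \ Y : Finset (Fin N)) : Set (Fin N))) = ⊤
    · exact Submodule.mem_sup_left
        (Submodule.subset_span ⟨Y, Finset.subset_univ _, hY, rfl⟩)
    · exact Submodule.mem_sup_right (prodPoly_mem_Jideal hY)
  | add p q hp hq =>
    rw [mul_add]
    exact add_mem (hp Y) (hq Y)
  | mul_X q i hq =>
    by_cases hY : Submodule.span ℝ
        (X '' ((Finset.univ \ Y : Finset (Fin N)) : Set (Fin N))) = ⊤
    · exact prodPoly_mul_mul_X_mem hY _ q (fun j _ => hq _) i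
    · exact Submodule.mem_sup_right (Ideal.mul_mem_right _ _ (prodPoly_mem_Jideal hY))

lemma isCompl_PspaceOn_Jideal (X : Fin N → Fin r → ℝ) : IsCompl (PspaceOn X Finset.univ)
    ((Jideal X Finset.univ (basesOn X Finset.univ)).restrictScalars ℝ) := by
  constructor
  · exact Submodule.disjoint_def.mpr fun p hp hp' => eq_zero_of_mem_PspaceOn_of_mem_Jideal hp hp'
  · refine codisjoint_iff.mpr (eq_top_iff.mpr fun q _ => ?_)
    simpa [prodPoly] using prodPoly_mul_mem_sup X q ∅

lemma prodPoly_mul_monomial_mem_Jideal (X : Fin N → Fin r → ℝ) (k : ℕ) (α : Fin r →₀ ℕ)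
    (hα : α.degree = k) (Y : Finset (Fin N)) (hY : N < Y.card + k) :
    prodPoly X Y * MvPolynomial.monomial α 1 ∈
      Jideal X Finset.univ (basesOn X Finset.univ) := by
  induction k generalizing α Y with
  | zero =>
    have := Finset.card_le_univ Y
    rw [Fintype.card_fin] at this
    omega
  | succ k ih =>
    by_cases hspan : Submodule.span ℝ
        (X '' ((Finset.univ \ Y : Finset (Fin N)) : Set (Fin N))) = ⊤
    · obtain ⟨i, hi⟩ : ∃ i, α i ≠ 0 := by
        by_contra! h
        have : α = 0 := Finsupp.ext h
        simp [this] at hα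
      obtain ⟨β, rfl⟩ : ∃ β, α = β + Finsupp.single i 1 :=
        ⟨α - Finsupp.single i 1, (tsub_add_cancel_of_le
          (Finsupp.single_le_iff.mpr (Nat.one_le_iff_ne_zero.mpr hi))).symm⟩
      rw [map_add, Finsupp.degree_single, Nat.add_right_cancel_iff] at hα
      have := prodPoly_mul_mul_X_mem hspan
        ((Jideal X Finset.univ (basesOn X Finset.univ)).restrictScalars ℝ)
        (MvPolynomial.monomial β 1) (fun j hj => ih β hα (insert j Y) (by
          rw [Finset.card_insert_of_notMem hj]
          omega)) i
      rwa [MvPolynomial.X, MvPolynomial.monomial_mul, one_mul] at this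
    · exact Ideal.mul_mem_right _ _ (prodPoly_mem_Jideal hspan)

lemma monomial_mem_Jideal (X : Fin N → Fin r → ℝ) (α : Fin r →₀ ℕ) (hα : N < α.degree) :
    MvPolynomial.monomial α 1 ∈ Jideal X Finset.univ (basesOn X Finset.univ) := by
  simpa [prodPoly] using
    prodPoly_mul_monomial_mem_Jideal X α.degree α rfl ∅ (by simpa using hα)

end Complement

/-- the map `𝒟(X) → 𝒫(X)^*`, `f ↦ (p ↦ ⟨p,f⟩)`, is an isomorphism. -/
theorem statement2 {r N : ℕ} (X : Fin N → Fin r → ℝ)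
    (hX : Submodule.span ℝ (Set.range X) = ⊤) :
    ∃ e : ↥(Dspace X Finset.univ (basesOn X Finset.univ)) ≃ₗ[ℝ]
        Module.Dual ℝ ↥(PspaceOn X Finset.univ),
      ∀ (f : ↥(Dspace X Finset.univ (basesOn X Finset.univ)))
        (p : ↥(PspaceOn X Finset.univ)), e f p = pairing p.1 f.1 := by
  have hcompl := isCompl_PspaceOn_Jideal X
  let φ : ↥(Dspace X Finset.univ (basesOn X Finset.univ)) →ₗ[ℝ]
      Module.Dual ℝ ↥(PspaceOn X Finset.univ) :=
    (pairingBilin r).compl₁₂ (Submodule.subtype _) (Submodule.subtype _)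
  have hφ : ∀ f p, φ f p = pairing p.1 f.1 := fun _ _ => rfl
  refine ⟨LinearEquiv.ofBijective φ ⟨(injective_iff_map_eq_zero φ).mpr fun f hf => ?_,
    fun ψ => ?_⟩, hφ⟩
  · refine Subtype.ext (eq_zero_of_forall_pairing_eq_zero fun q => ?_)
    obtain ⟨p, hp, j, hj, rfl⟩ := Submodule.mem_sup.mp
      (hcompl.sup_eq_top ▸ Submodule.mem_top : q ∈ _)
    rw [pairing_add_left, f.2 j hj, add_zero]
    exact LinearMap.congr_fun hf ⟨p, hp⟩
  · have hker : ∀ q ∈ Jideal X Finset.univ (basesOn X Finset.univ),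
        (ψ ∘ₗ Submodule.projectionOnto _ _ hcompl) q = 0 := fun q hq => by
      rw [LinearMap.comp_apply, (Submodule.projectionOnto_apply_eq_zero_iff hcompl).mpr hq,
        map_zero]
    obtain ⟨f, hf⟩ := exists_pairing_eq (ψ ∘ₗ Submodule.projectionOnto _ _ hcompl) N
      fun α hα => hker _ (monomial_mem_Jideal X α hα)
    refine ⟨⟨f, fun q hq => (hf q).trans (hker q hq)⟩, LinearMap.ext fun p => ?_⟩
    rw [hφ, hf, LinearMap.comp_apply, Submodule.projectionOnto_apply_left]
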